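/- Let f : X → Y be a morphism of schemes which is integral and surjective. If X is a separated scheme, then Y is a separated scheme. -/

import Mathlib

open AlgebraicGeometry

open CategoryTheory Limits in
/-- If `f` is surjective and universally closed and `f ≫ g` is separated, then `g` is separated. -/
theorem isSeparated_of_comp_of_universallyClosed_of_surjective {X Y S : Scheme}
    (f : X ⟶ Y) (g : Y ⟶ S) [UniversallyClosed f] [Surjective f] [IsSeparated (f ≫ g)] :
    IsSeparated g := by
  have h : pullback.diagonal (f ≫ g) ≫
      pullback.map (f ≫ g) (f ≫ g) g g f f (𝟙 _) (by simp) (by simp) =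
      f ≫ pullback.diagonal g := by
    apply pullback.hom_ext
    · simp only [Category.assoc, pullback.diagonal_fst, pullback.map]
      erw [pullback.lift_fst]
      simp
    · simp only [Category.assoc, pullback.diagonal_snd, pullback.map]
      erw [pullback.lift_snd]
      simp
  have : UniversallyClosed
      (pullback.map (f ≫ g) (f ≫ g) g g f f (𝟙 _) (by simp) (by simp)) :=
    MorphismProperty.pullbackMap ‹_› ‹_› rfl rfl
  have : UniversallyClosed (f ≫ pullback.diagonal g) := h ▸ inferInstance
  have := UniversallyClosed.of_comp_surjective f (pullback.diagonal g)
  exact ⟨.of_isPreimmersion _ (pullback.diagonal g).isClosedMap.isClosed_range⟩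

/-- If `f : X ⟶ Y` is an integral surjective morphism of schemes and `X` is separated,
then `Y` is separated. -/
theorem isSeparated_of_integral_surjective {X Y : Scheme} (f : X ⟶ Y)
    [IsIntegralHom f] [Surjective f] [X.IsSeparated] : Y.IsSeparated :=
  ⟨isSeparated_of_comp_of_universallyClosed_of_surjective f _⟩
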